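/- arXiv:2002.05118 — 2 statements merged into one kernel-verified Lean document; each statement's English description precedes it below -/
import Mathlib

section
/- Gauss–Legendre quadrature: for every natural number n ≥ 1 there exist real weights w_1, …, w_n such that for every function f that is 2n times continuously differentiable on [−1, 1], |∫_{−1}^{1} f(y) dy − Σ_{i=1}^{n} w_i f(x_i)| ≤ π · 2^{−2n} · sup_{ξ ∈ [−1,1]} |f^{(2n)}(ξ)| / (2n)!, where x_1, …, x_n are the zeros of the monic Legendre polynomial p_n. -/
open Polynomial

/-- The monic Legendre polynomial, given by Rodrigues' formula normalized to be monic: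
`p_n(x) = (n!/(2n)!) · dⁿ/dxⁿ[(x²−1)ⁿ]`. -/
noncomputable def legendreMonic (n : ℕ) : Polynomial ℝ :=
  Polynomial.C ((n.factorial : ℝ) / ((2 * n).factorial : ℝ)) *
    Polynomial.derivative^[n] ((Polynomial.X ^ 2 - 1) ^ n)

open MeasureTheory Filter Topology

/-- **Generalized Rolle theorem**: if `g k` has derivative `g (k + 1)` for `k < N` and `g 0` has
`N + 1` zeros, then `g N` has a zero. -/
theorem exists_zero_of_derivative_chain {a b : ℝ} (N : ℕ) :
    ∀ (g : ℕ → ℝ → ℝ) (z : ℕ → ℝ),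
      (∀ k < N, ContinuousOn (g k) (Set.Icc a b)) →
      (∀ k < N, ∀ x ∈ Set.Ioo a b, HasDerivAt (g k) (g (k + 1) x) x) →
      (∀ i < N, z i < z (i + 1)) → (∀ i ≤ N, z i ∈ Set.Icc a b) → (∀ i ≤ N, g 0 (z i) = 0) →
      ∃ ξ ∈ Set.Icc a b, g N ξ = 0 := by
  induction N with
  | zero => exact fun g z _ _ _ hz h0 => ⟨z 0, hz 0 le_rfl, h0 0 le_rfl⟩
  | succ N ih =>
    intro g z hc hd hlt hz h0
    have rolle : ∀ i, ∃ c, i ≤ N → c ∈ Set.Ioo (z i) (z (i + 1)) ∧ g 1 c = 0 := by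
      intro i
      by_cases hi : i ≤ N
      · obtain ⟨c, hcm, hc0⟩ := exists_hasDerivAt_eq_zero (f := g 0) (f' := g 1)
          (hlt i (by lia))
          ((hc 0 (by lia)).mono (Set.Icc_subset_Icc (hz i (by lia)).1 (hz (i + 1) (by lia)).2))
          (by rw [h0 i (by lia), h0 (i + 1) (by lia)])
          (fun x hx => hd 0 (by lia) x
            ⟨(hz i (by lia)).1.trans_lt hx.1, hx.2.trans_le (hz (i + 1) (by lia)).2⟩)
        exact ⟨c, fun _ => ⟨hcm, hc0⟩⟩
      · exact ⟨0, fun h => absurd h hi⟩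
    choose c hcz using rolle
    refine ih (fun k => g (k + 1)) c (fun k hk => hc (k + 1) (by lia))
      (fun k hk => hd (k + 1) (by lia)) (fun i hi => ?_) (fun i hi => ?_)
      (fun i hi => (hcz i hi).2)
    · exact (hcz i (by lia)).1.2.trans (hcz (i + 1) (by lia)).1.1
    · exact ⟨(hz i (by lia)).1.trans (hcz i hi).1.1.le,
        (hcz i hi).1.2.le.trans (hz (i + 1) (by lia)).2⟩

theorem iterate_derivative_eq_C_of_natDegree_le {p : ℝ[X]} {N : ℕ} (hp : p.natDegree ≤ N) :
    derivative^[N] p = C (N.factorial * p.coeff N) := by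
  have h0 : (derivative^[N] p).natDegree = 0 := by
    have := natDegree_iterate_derivative p N
    lia
  rw [eq_C_of_natDegree_eq_zero h0, coeff_iterate_derivative]
  simp [Nat.descFactorial_self]

/-- Error bound for Lagrange interpolation of a `C^N` function at `N` distinct nodes. -/
theorem abs_sub_eval_le_of_eqOn_nodes {a b : ℝ} (hab : a < b) {f : ℝ → ℝ} (s : Finset ℝ)
    (hf : ContDiffOn ℝ (s.card : ℕ) f (Set.Icc a b)) (hs : ∀ t ∈ s, t ∈ Set.Icc a b) {P : ℝ[X]}
    (hP : P.degree < s.card) (hPs : ∀ t ∈ s, P.eval t = f t) {S : ℝ}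
    (hS : ∀ ξ ∈ Set.Icc a b,
      |iteratedDerivWithin s.card f (Set.Icc a b) ξ| / s.card.factorial ≤ S)
    {y : ℝ} (hy : y ∈ Set.Icc a b) :
    |f y - P.eval y| ≤ S * |∏ t ∈ s, (y - t)| := by
  by_cases hys : y ∈ s
  · rw [hPs y hys, Finset.prod_eq_zero hys (sub_self y)]
    simp
  set N := s.card with hN
  have hprod : ∏ t ∈ s, (y - t) ≠ 0 :=
    Finset.prod_ne_zero_iff.2 fun t ht h => hys (sub_eq_zero.1 h ▸ ht)
  set K := (f y - P.eval y) / ∏ t ∈ s, (y - t) with hK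
  have hKmul : K * ∏ t ∈ s, (y - t) = f y - P.eval y := div_mul_cancel₀ _ hprod
  set W : ℝ[X] := ∏ t ∈ s, (X - C t) with hW
  have hWeval : ∀ u, W.eval u = ∏ t ∈ s, (u - t) := fun u => by simp [hW, eval_prod]
  have hWmonic : W.Monic := monic_prod_X_sub_C _ s
  have hWdeg : W.natDegree = N := by
    rw [hW, natDegree_prod_of_monic _ _ fun t _ => monic_X_sub_C t]
    simp [hN]
  have hderiv : derivative^[N] (P + C K * W) = C (N.factorial * K) := by
    rw [iterate_map_add, iterate_derivative_eq_zero_of_degree_lt hP, iterate_derivative_C_mul,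
      iterate_derivative_eq_C_of_natDegree_le hWdeg.le]
    have : W.coeff N = 1 := by rw [← hWdeg]; exact hWmonic
    rw [this, ← C_mul]
    simp
    ring
  have hcard : (insert y s).card = N + 1 := Finset.card_insert_of_notMem hys
  set e := (insert y s).orderEmbOfFin hcard
  set z : ℕ → ℝ := fun i => if h : i < N + 1 then e ⟨i, h⟩ else 0 with hz
  have hzmem : ∀ i ≤ N, z i ∈ insert y s := fun i hi => by
    simp only [hz, dif_pos (Nat.lt_succ_of_le hi)]
    exact Finset.orderEmbOfFin_mem _ _ _
  have hun := uniqueDiffOn_Icc hab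
  obtain ⟨ξ, hξ, hξ0⟩ := exists_zero_of_derivative_chain (a := a) (b := b) N
    (fun k u => iteratedDerivWithin k f (Set.Icc a b) u - (derivative^[k] (P + C K * W)).eval u) z
    (fun k hk => (hf.continuousOn_iteratedDerivWithin (by exact_mod_cast hk.le) hun).sub
      (Polynomial.continuous _).continuousOn)
    (fun k hk u hu => by
      have hmem : Set.Icc a b ∈ 𝓝 u := Icc_mem_nhds hu.1 hu.2
      have h1 := ((hf.differentiableOn_iteratedDerivWithin (m := k) (by exact_mod_cast hk) hun)
        u ⟨hu.1.le, hu.2.le⟩).hasDerivWithinAt.hasDerivAt hmem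
      rw [← iteratedDerivWithin_succ] at h1
      have h2 := (derivative^[k] (P + C K * W)).hasDerivAt u
      rw [← Function.iterate_succ_apply' derivative] at h2
      exact h1.sub h2)
    (fun i hi => by
      simp only [hz, dif_pos (show i < N + 1 by lia), dif_pos (show i + 1 < N + 1 by lia)]
      exact e.strictMono (by simp))
    (fun i hi => by
      rcases Finset.mem_insert.1 (hzmem i hi) with h | h
      · rw [h]; exact hy
      · exact hs _ h)
    (fun i hi => by
      simp only [iteratedDerivWithin_zero, Function.iterate_zero, id, eval_add, eval_mul, eval_C,
        hWeval]
      rcases Finset.mem_insert.1 (hzmem i hi) with h | h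
      · rw [h, hKmul]; ring
      · rw [hPs _ h, Finset.prod_eq_zero h (sub_self _)]; ring)
  rw [hderiv, eval_C, sub_eq_zero] at hξ0
  have hKS : |K| ≤ S := by
    refine le_trans (le_of_eq ?_) (hS ξ hξ)
    have : (0 : ℝ) < N.factorial := by positivity
    rw [hξ0, abs_mul, abs_of_pos this]
    field_simp
  rw [← hKmul, abs_mul]
  exact mul_le_mul_of_nonneg_right hKS (abs_nonneg _)

theorem intervalIntegrable_eval (p : ℝ[X]) (a b : ℝ) :
    IntervalIntegrable (fun y => p.eval y) volume a b :=
  p.continuous.intervalIntegrable a b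

/-- Repeated integration by parts against the derivatives of `(X² - 1)ⁿ`. -/
theorem integral_mul_iterate_derivative_sq_sub_one_pow (n m : ℕ) (hm : m ≤ n) (q : ℝ[X]) :
    ∫ y in (-1:ℝ)..1, q.eval y * (derivative^[m] ((X ^ 2 - 1 : ℝ[X]) ^ n)).eval y =
      (-1) ^ m * ∫ y in (-1:ℝ)..1, (derivative^[m] q).eval y * (y ^ 2 - 1) ^ n := by
  induction m generalizing q with
  | zero => simp
  | succ m ih =>
    have hdvd : (X ^ 2 - 1 : ℝ[X]) ∣ derivative^[m] ((X ^ 2 - 1 : ℝ[X]) ^ n) :=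
      (dvd_pow_self _ (by lia)).trans (pow_sub_dvd_iterate_derivative_pow (X ^ 2 - 1 : ℝ[X]) n m)
    obtain ⟨R, hR⟩ := hdvd
    rw [Function.iterate_succ_apply', Function.iterate_succ_apply,
      intervalIntegral.integral_mul_deriv_eq_deriv_mul (fun y _ => q.hasDerivAt y)
        (fun y _ => Polynomial.hasDerivAt _ y) (intervalIntegrable_eval _ _ _)
        (intervalIntegrable_eval _ _ _), ih (by lia), hR]
    simp
    ring

theorem monic_sq_sub_one_pow (n : ℕ) : ((X ^ 2 - 1 : ℝ[X]) ^ n).Monic :=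
  (monic_X_pow_sub_C (1 : ℝ) two_ne_zero).pow n

theorem natDegree_sq_sub_one_pow (n : ℕ) : ((X ^ 2 - 1 : ℝ[X]) ^ n).natDegree = 2 * n := by
  have h : (X ^ 2 - 1 : ℝ[X]).natDegree = 2 := natDegree_X_pow_sub_C (r := (1 : ℝ))
  rw [natDegree_pow, h, mul_comm]

theorem natDegree_legendreMonic_le (n : ℕ) : (legendreMonic n).natDegree ≤ n := by
  refine (natDegree_C_mul_le _ _).trans ((natDegree_iterate_derivative _ _).trans ?_)
  rw [natDegree_sq_sub_one_pow]
  lia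

theorem coeff_legendreMonic_self (n : ℕ) : (legendreMonic n).coeff n = 1 := by
  have h : ((X ^ 2 - 1 : ℝ[X]) ^ n).coeff (n + n) = 1 := by
    rw [← two_mul, ← natDegree_sq_sub_one_pow n]
    exact monic_sq_sub_one_pow n
  have hfac := Nat.factorial_mul_descFactorial (show n ≤ n + n by lia)
  rw [Nat.add_sub_cancel, ← two_mul] at hfac
  rw [legendreMonic, coeff_C_mul, coeff_iterate_derivative, h, ← hfac, ← two_mul]
  have h1 : ((2 * n).descFactorial n : ℝ) ≠ 0 := by
    exact_mod_cast (Nat.descFactorial_pos.2 (by lia)).ne'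
  have h2 : (n.factorial : ℝ) ≠ 0 := by positivity
  push_cast
  rw [nsmul_eq_mul]
  field_simp

theorem monic_legendreMonic (n : ℕ) : (legendreMonic n).Monic :=
  monic_of_natDegree_le_of_coeff_eq_one n (natDegree_legendreMonic_le n)
    (coeff_legendreMonic_self n)

theorem natDegree_legendreMonic (n : ℕ) : (legendreMonic n).natDegree = n :=
  natDegree_eq_of_le_of_coeff_ne_zero (natDegree_legendreMonic_le n)
    (by simp [coeff_legendreMonic_self])

theorem integral_mul_legendreMonic (n : ℕ) (q : ℝ[X]) :
    ∫ y in (-1:ℝ)..1, q.eval y * (legendreMonic n).eval y =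
      (n.factorial / (2 * n).factorial : ℝ) * ((-1) ^ n *
        ∫ y in (-1:ℝ)..1, (derivative^[n] q).eval y * (y ^ 2 - 1) ^ n) := by
  rw [← integral_mul_iterate_derivative_sq_sub_one_pow n n le_rfl q,
    ← intervalIntegral.integral_const_mul]
  congr 1 with y
  simp only [legendreMonic, eval_mul, eval_C]
  ring

theorem integral_mul_legendreMonic_eq_zero {n : ℕ} {q : ℝ[X]} (hq : q.degree < n) :
    ∫ y in (-1:ℝ)..1, q.eval y * (legendreMonic n).eval y = 0 := by
  rw [integral_mul_legendreMonic, iterate_derivative_eq_zero_of_degree_lt hq]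
  simp

theorem integral_one_sub_sq_pow (n : ℕ) :
    ∫ y in (-1:ℝ)..1, (1 - y ^ 2) ^ n =
      2 * ∏ i ∈ Finset.range n, (2 * (i : ℝ) + 2) / (2 * i + 3) := by
  have h := integral_sin_pow_odd_mul_cos_pow (a := 0) (b := Real.pi) n 0
  simp only [pow_zero, mul_one, one_mul, Real.cos_pi, Real.cos_zero] at h
  rw [← h, integral_sin_pow_odd]

theorem integral_legendreMonic_sq (n : ℕ) :
    ∫ y in (-1:ℝ)..1, (legendreMonic n).eval y * (legendreMonic n).eval y =
      (n.factorial : ℝ) ^ 2 / (2 * n).factorial *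
        (2 * ∏ i ∈ Finset.range n, (2 * (i : ℝ) + 2) / (2 * i + 3)) := by
  rw [integral_mul_legendreMonic,
    iterate_derivative_eq_C_of_natDegree_le (natDegree_legendreMonic_le n),
    coeff_legendreMonic_self, ← integral_one_sub_sq_pow, ← intervalIntegral.integral_const_mul,
    ← intervalIntegral.integral_const_mul, ← intervalIntegral.integral_const_mul]
  congr 1 with y
  have h : (1 - y ^ 2) ^ n = (-1) ^ n * (y ^ 2 - 1) ^ n := by rw [← mul_pow]; ring
  rw [h, eval_C]
  ring

theorem factorial_sq_div_mul_prod_eq_wallis (n : ℕ) :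
    (n.factorial : ℝ) ^ 2 / (2 * n).factorial *
        (2 * ∏ i ∈ Finset.range n, (2 * (i : ℝ) + 2) / (2 * i + 3)) =
      2 * Real.Wallis.W n * (4 ^ n)⁻¹ := by
  induction n with
  | zero => simp [Real.Wallis.W]
  | succ n ih =>
    rw [Finset.prod_range_succ, Real.Wallis.W_succ,
      show 2 * (n + 1) = 2 * n + 1 + 1 by ring, Nat.factorial_succ, Nat.factorial_succ (2 * n + 1),
      Nat.factorial_succ (2 * n)]
    have h1 : ((2 * n).factorial : ℝ) ≠ 0 := by positivity
    have h2 : (2 * (n : ℝ) + 1) ≠ 0 := by positivity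
    have h3 : (2 * (n : ℝ) + 3) ≠ 0 := by positivity
    have h4 : (n : ℝ) + 1 ≠ 0 := by positivity
    push_cast
    calc _ = ((n.factorial : ℝ) ^ 2 / (2 * n).factorial *
          (2 * ∏ i ∈ Finset.range n, (2 * (i : ℝ) + 2) / (2 * i + 3))) *
          ((2 * n + 2) / (2 * n + 1) * ((2 * n + 2) / (2 * n + 3)) / 4) := by
            field_simp
            ring
      _ = _ := by
            rw [ih, pow_succ]
            field_simp

/-- The squared `L²` norm of the monic Legendre polynomial is `2·4⁻ⁿ` times a partial Wallis
product. -/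
theorem integral_legendreMonic_sq_le (n : ℕ) :
    ∫ y in (-1:ℝ)..1, |(legendreMonic n).eval y * (legendreMonic n).eval y| ≤
      Real.pi * (2:ℝ) ^ (-(2 * (n:ℤ))) := by
  simp only [abs_mul_self]
  rw [integral_legendreMonic_sq, factorial_sq_div_mul_prod_eq_wallis]
  have h4 : (2:ℝ) ^ (-(2 * (n:ℤ))) = (4 ^ n)⁻¹ := by
    rw [zpow_neg, zpow_mul]
    norm_num
  rw [h4]
  exact mul_le_mul_of_nonneg_right (by linarith [Real.Wallis.W_le n]) (by positivity)

section Nodes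

variable {n : ℕ} {x : Fin n → ℝ}

theorem legendreMonic_eq_prod (hx : Function.Injective x)
    (hroot : ∀ i, (legendreMonic n).eval (x i) = 0) :
    legendreMonic n = ∏ i, (X - C (x i)) := by
  have hn : Lagrange.nodal Finset.univ x = ∏ i, (X - C (x i)) := rfl
  rw [← hn]
  have hd : (legendreMonic n).degree = n := by
    rw [degree_eq_natDegree (monic_legendreMonic n).ne_zero, natDegree_legendreMonic]
  refine eq_of_degree_le_of_eval_index_eq (v := x) Finset.univ hx.injOn ?_ ?_ ?_ ?_
  · simp [hd]
  · simp [hd, Lagrange.degree_nodal]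
  · rw [(monic_legendreMonic n).leadingCoeff, Lagrange.nodal_monic.leadingCoeff]
  · intro i hi
    rw [hroot, Lagrange.eval_nodal_at_node hi]

/-- The Gauss–Legendre weights attached to the nodes `x`. -/
noncomputable def gaussWeight (x : Fin n → ℝ) (i : Fin n) : ℝ :=
  ∫ y in (-1:ℝ)..1, (Lagrange.basis Finset.univ x i).eval y

theorem integral_eval_eq_sum_of_degree_lt_card (hx : Function.Injective x) {r : ℝ[X]}
    (hr : r.degree < n) :
    ∫ y in (-1:ℝ)..1, r.eval y = ∑ i, gaussWeight x i * r.eval (x i) := by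
  have h := Lagrange.eq_interpolate (s := Finset.univ) (v := x) hx.injOn (f := r) (by simpa using hr)
  have he : ∀ y, r.eval y =
      ∑ i, r.eval (x i) * (Lagrange.basis Finset.univ x i).eval y := fun y => by
    conv_lhs => rw [h, Lagrange.interpolate_apply, eval_finsetSum]
    simp
  rw [show (fun y => r.eval y) = _ from funext he, intervalIntegral.integral_finsetSum
    fun i _ => (intervalIntegrable_eval _ _ _).const_mul _]
  refine Finset.sum_congr rfl fun i _ => ?_
  rw [intervalIntegral.integral_const_mul, gaussWeight, mul_comm]

/-- Gauss–Legendre quadrature is exact on polynomials of degree less than `2n`. -/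
theorem integral_eval_eq_sum_gaussWeight (hx : Function.Injective x)
    (hroot : ∀ i, (legendreMonic n).eval (x i) = 0) {P : ℝ[X]}
    (hP : P.degree < (2 * n : ℕ)) :
    ∫ y in (-1:ℝ)..1, P.eval y = ∑ i, gaussWeight x i * P.eval (x i) := by
  have hmon := monic_legendreMonic n
  have hd : (legendreMonic n).degree = n := by
    rw [degree_eq_natDegree hmon.ne_zero, natDegree_legendreMonic]
  have hr : (P %ₘ legendreMonic n).degree < n := hd ▸ degree_modByMonic_lt P hmon
  have hdecomp : ∀ y, P.eval y = (P %ₘ legendreMonic n).eval y +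
      (P /ₘ legendreMonic n).eval y * (legendreMonic n).eval y := fun y => by
    conv_lhs => rw [← modByMonic_add_div P (legendreMonic n)]
    rw [eval_add, eval_mul, mul_comm (eval y (legendreMonic n))]
  have hq : (P /ₘ legendreMonic n).degree < n := by
    by_cases h0 : P /ₘ legendreMonic n = 0
    · simp [h0]
    have h1 := natDegree_divByMonic P hmon
    rw [natDegree_legendreMonic] at h1
    have hP0 : P ≠ 0 := fun h => h0 (by simp [h])
    have h2 := (natDegree_lt_iff_degree_lt hP0).2 hP
    refine (natDegree_lt_iff_degree_lt h0).1 ?_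
    lia
  have hint : IntervalIntegrable
      (fun y => (P /ₘ legendreMonic n).eval y * (legendreMonic n).eval y) volume (-1) 1 :=
    ((Polynomial.continuous _).mul (Polynomial.continuous _)).intervalIntegrable _ _
  simp_rw [hdecomp, hroot, mul_zero, add_zero]
  rw [intervalIntegral.integral_add (intervalIntegrable_eval _ _ _) hint,
    integral_mul_legendreMonic_eq_zero hq, add_zero, integral_eval_eq_sum_of_degree_lt_card hx hr]

/-- Error bound obtained by interpolating at the nodes `x i` and the shifted nodes `x i + ε`. -/
theorem abs_integral_sub_sum_le_of_shift (hx : Function.Injective x)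
    (hmem : ∀ i, x i ∈ Set.Ioo (-1:ℝ) 1)
    (hroot : ∀ i, (legendreMonic n).eval (x i) = 0) {f : ℝ → ℝ}
    (hf : ContDiffOn ℝ (2 * n : ℕ) f (Set.Icc (-1:ℝ) 1)) {S : ℝ}
    (hS : ∀ ξ ∈ Set.Icc (-1:ℝ) 1,
      |iteratedDerivWithin (2 * n) f (Set.Icc (-1:ℝ) 1) ξ| / (2 * n).factorial ≤ S)
    {ε : ℝ} (hε : ∀ i, x i + ε ∈ Set.Icc (-1:ℝ) 1) (hne : ∀ i j, x i ≠ x j + ε) :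
    |(∫ y in (-1:ℝ)..1, f y) - ∑ i, gaussWeight x i * f (x i)| ≤
      S * ∫ y in (-1:ℝ)..1, |(legendreMonic n).eval y * (legendreMonic n).eval (y - ε)| := by
  classical
  set s₁ := Finset.univ.image x with hs₁
  set s₂ := Finset.univ.image fun i => x i + ε with hs₂
  have hx₂ : Function.Injective fun i => x i + ε := fun i j h => hx (add_right_cancel h)
  have hdisj : Disjoint s₁ s₂ := by
    rw [Finset.disjoint_left]
    intro t h1 h2
    obtain ⟨i, -, rfl⟩ := Finset.mem_image.1 h1
    obtain ⟨j, -, hj⟩ := Finset.mem_image.1 h2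
    exact hne i j hj.symm
  have hcard : (s₁ ∪ s₂).card = 2 * n := by
    rw [Finset.card_union_of_disjoint hdisj, Finset.card_image_of_injective _ hx,
      Finset.card_image_of_injective _ hx₂]
    simp [two_mul]
  have hprod : ∀ y, ∏ t ∈ s₁ ∪ s₂, (y - t) =
      (legendreMonic n).eval y * (legendreMonic n).eval (y - ε) := fun y => by
    rw [Finset.prod_union hdisj, Finset.prod_image hx.injOn, Finset.prod_image hx₂.injOn,
      legendreMonic_eq_prod hx hroot]
    simp only [eval_prod, eval_sub, eval_X, eval_C]
    congr 1
    exact Finset.prod_congr rfl fun i _ => by ring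
  set P := Lagrange.interpolate (s₁ ∪ s₂) id f with hP
  have hPdeg : P.degree < (s₁ ∪ s₂).card := Lagrange.degree_interpolate_lt f (Set.injOn_id _)
  have hPeval : ∀ t ∈ s₁ ∪ s₂, P.eval t = f t := fun t ht =>
    Lagrange.eval_interpolate_at_node (v := id) f (Set.injOn_id _) ht
  have hsmem : ∀ t ∈ s₁ ∪ s₂, t ∈ Set.Icc (-1:ℝ) 1 := by
    intro t ht
    rcases Finset.mem_union.1 ht with h | h
    · obtain ⟨i, -, rfl⟩ := Finset.mem_image.1 h
      exact Set.Ioo_subset_Icc_self (hmem i)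
    · obtain ⟨i, -, rfl⟩ := Finset.mem_image.1 h
      exact hε i
  have hbound : ∀ y ∈ Set.Icc (-1:ℝ) 1, |f y - P.eval y| ≤
      S * |(legendreMonic n).eval y * (legendreMonic n).eval (y - ε)| := fun y hy => by
    rw [← hprod]
    exact abs_sub_eval_le_of_eqOn_nodes (by norm_num) (s₁ ∪ s₂) (by rwa [hcard]) hsmem hPdeg
      hPeval (by rwa [hcard]) hy
  have hfint : IntervalIntegrable f volume (-1) 1 :=
    ContinuousOn.intervalIntegrable_of_Icc (by norm_num) hf.continuousOn
  have hsum : ∑ i, gaussWeight x i * f (x i) = ∫ y in (-1:ℝ)..1, P.eval y := by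
    rw [integral_eval_eq_sum_gaussWeight hx hroot (hcard ▸ hPdeg)]
    refine Finset.sum_congr rfl fun i _ => ?_
    rw [hPeval _ (Finset.mem_union_left _ (Finset.mem_image_of_mem x (Finset.mem_univ i)))]
  rw [hsum, ← intervalIntegral.integral_sub hfint (intervalIntegrable_eval _ _ _),
    ← intervalIntegral.integral_const_mul]
  rw [← Real.norm_eq_abs]
  refine intervalIntegral.norm_integral_le_of_norm_le (by norm_num)
    (ae_of_all _ fun y hy => (Real.norm_eq_abs _).le.trans <| hbound y ⟨hy.1.le, hy.2⟩) (Continuous.intervalIntegrable ?_ _ _)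
  fun_prop

end Nodes

/-- Gauss–Legendre quadrature: for every `n ≥ 1` and every enumeration `x_1 < ⋯ < x_n` of the
zeros of the monic Legendre polynomial `p_n` (which lie in `(−1,1)`), there exist weights
`w_1, …, w_n` such that for every `f` that is `2n` times continuously differentiable on
`[−1,1]`,
`|∫_{−1}^{1} f − Σ_i w_i f(x_i)| ≤ π·2^{−2n}· sup_{ξ∈[−1,1]} |f^{(2n)}(ξ)|/(2n)!`. -/
theorem gauss_legendre_quadrature (n : ℕ) (hn : 1 ≤ n) (x : Fin n → ℝ)
    (hmono : StrictMono x) (hmem : ∀ i, x i ∈ Set.Ioo (-1:ℝ) 1)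
    (hroot : ∀ i, (legendreMonic n).eval (x i) = 0) :
    ∃ w : Fin n → ℝ, ∀ f : ℝ → ℝ, ContDiffOn ℝ (2 * n : ℕ) f (Set.Icc (-1:ℝ) 1) →
      |(∫ y in (-1:ℝ)..1, f y) - ∑ i : Fin n, w i * f (x i)| ≤
        Real.pi * (2:ℝ) ^ (-(2 * (n:ℤ))) *
          ⨆ ξ : Set.Icc (-1:ℝ) 1,
            |iteratedDerivWithin (2 * n) f (Set.Icc (-1:ℝ) 1) ξ| / (2 * n).factorial := by
  have hx := hmono.injective
  refine ⟨gaussWeight x, fun f hf => ?_⟩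
  set S := ⨆ ξ : Set.Icc (-1:ℝ) 1,
    |iteratedDerivWithin (2 * n) f (Set.Icc (-1:ℝ) 1) ξ| / (2 * n).factorial with hSdef
  have hcont : ContinuousOn (fun ξ : ℝ =>
      |iteratedDerivWithin (2 * n) f (Set.Icc (-1:ℝ) 1) ξ| / ((2 * n).factorial : ℝ))
      (Set.Icc (-1:ℝ) 1) :=
    ((hf.continuousOn_iteratedDerivWithin le_rfl
      (uniqueDiffOn_Icc (by norm_num))).abs).div_const _
  have hbdd : BddAbove (Set.range fun ξ : Set.Icc (-1:ℝ) 1 =>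
      |iteratedDerivWithin (2 * n) f (Set.Icc (-1:ℝ) 1) ξ| / ((2 * n).factorial : ℝ)) := by
    obtain ⟨B, hB⟩ := isCompact_Icc.bddAbove_image hcont
    refine ⟨B, ?_⟩
    rintro _ ⟨ξ, rfl⟩
    exact hB ⟨ξ, ξ.2, rfl⟩
  have hS : ∀ ξ ∈ Set.Icc (-1:ℝ) 1,
      |iteratedDerivWithin (2 * n) f (Set.Icc (-1:ℝ) 1) ξ| / (2 * n).factorial ≤ S :=
    fun ξ hξ => le_ciSup hbdd ⟨ξ, hξ⟩
  have hS0 : 0 ≤ S := le_trans (by positivity) (hS 0 (by norm_num))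
  have hI : Continuous fun ε : ℝ =>
      S * ∫ y in (-1:ℝ)..1, |(legendreMonic n).eval y * (legendreMonic n).eval (y - ε)| := by
    refine continuous_const.mul
      (intervalIntegral.continuous_parametric_intervalIntegral_of_continuous' ?_ _ _)
    simp only [Function.uncurry_def]
    fun_prop
  have hlim := (hI.tendsto 0).mono_left (nhdsWithin_le_nhds (s := Set.Ioi 0))
  simp only [sub_zero] at hlim
  have hmem_ev : ∀ᶠ ε in 𝓝[>] (0:ℝ), ∀ i, x i + ε ∈ Set.Icc (-1:ℝ) 1 := by
    refine eventually_all.2 fun i => nhdsWithin_le_nhds ?_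
    have hc : ContinuousAt (fun ε => x i + ε) 0 := by fun_prop
    exact hc (Icc_mem_nhds (by simpa using (hmem i).1) (by simpa using (hmem i).2))
  have hne_ev : ∀ᶠ ε in 𝓝[>] (0:ℝ), ∀ i j, x i ≠ x j + ε := by
    refine eventually_all.2 fun i => eventually_all.2 fun j => ?_
    by_cases hij : i = j
    · filter_upwards [self_mem_nhdsWithin] with ε hε h
      rw [hij] at h
      have : 0 < ε := hε
      linarith
    · have hc : ContinuousAt (fun ε => x j + ε) 0 := by fun_prop
      refine nhdsWithin_le_nhds ((hc.eventually_ne (y := x i) ?_).mono fun ε h => h.symm)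
      simpa using fun h : x j = x i => hij (hx h).symm
  have hle := ge_of_tendsto hlim (by
    filter_upwards [hmem_ev, hne_ev] with ε h1 h2
    exact abs_integral_sub_sum_le_of_shift hx hmem hroot hf hS h1 h2)
  refine hle.trans ?_
  rw [mul_comm]
  exact mul_le_mul_of_nonneg_right (integral_legendreMonic_sq_le n) hS0
end

section
/- Let N ≥ 20 and let n be an integer with 0 ≤ n ≤ N. Let z ∈ ℂ satisfy |Re(z)| > 0.95 · N^{3/2} · ln(N) and |Im(z)| ≤ 1. Then |J_n^+(z)| ≤ 3.36 · |z|^{−1/2}, where J_n^+(z) := ((z/2)^n / (Γ(n+1/2) Γ(1/2))) ∫_{−1}^{1} e^{i z t} (1−t²)^{n−1/2} dt. -/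
open Complex Real

/-- The half Bessel function `J_n^+`, defined via the Poisson-type integral
`J_n^+(z) = ((z/2)^n/(Γ(n+1/2)Γ(1/2))) ∫_{−1}^{1} e^{izt}(1−t²)^{n−1/2} dt`,
with the principal branch power. -/
noncomputable def besselJPlus (n : ℕ) (z : ℂ) : ℂ :=
  ((z / 2) ^ n / ((Real.Gamma ((n : ℝ) + 1 / 2) : ℂ) * (Real.Gamma (1 / 2) : ℂ))) *
    ∫ t in (-1:ℝ)..1, Complex.exp (Complex.I * z * (t : ℂ)) *
      ((1 : ℂ) - (t : ℂ) ^ 2) ^ ((((n : ℝ) - 1 / 2 : ℝ)) : ℂ)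

/-- The integrand of the Poisson integral, as a function of a complex variable. -/
noncomputable def poissonIntegrand (z : ℂ) (r : ℝ) (t : ℂ) : ℂ :=
  Complex.exp (Complex.I * z * t) * (1 - t ^ 2) ^ (r : ℂ)

theorem integral_rpow_mul_one_add_sq_pow_mul_exp_neg_le {x : ℝ} (hx : 0 < x) (m : ℕ) :
    ∀ p q : ℝ, 0 ≤ p → p + 2 * m ≤ q →
      MeasureTheory.IntegrableOn
        (fun b : ℝ => b ^ p * (1 + b ^ 2 / 4) ^ m * Real.exp (-(x * b))) (Set.Ioi 0) ∧
      ∫ b in Set.Ioi (0 : ℝ), b ^ p * (1 + b ^ 2 / 4) ^ m * Real.exp (-(x * b)) ≤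
        Real.Gamma (p + 1) / x ^ (p + 1) * (1 + q ^ 2 / (4 * x ^ 2)) ^ m := by
  induction m with
  | zero =>
    intro p q hp _
    constructor
    · simpa using integrableOn_rpow_mul_exp_neg_mul_rpow (s := p) (p := 1) (b := x)
        (by linarith) one_pos hx
    · have h := Real.integral_rpow_mul_exp_neg_mul_Ioi (a := p + 1) (by linarith) hx
      simp only [add_sub_cancel_right] at h
      simp only [pow_zero, mul_one, h]
      rw [Real.div_rpow zero_le_one hx.le, Real.one_rpow]
      exact le_of_eq (by ring)
  | succ m ih =>
    intro p q hp hq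
    push_cast at hq
    obtain ⟨i₁, h₁⟩ := ih p q hp (by linarith)
    obtain ⟨i₂, h₂⟩ := ih (p + 2) q (by linarith) (by linarith)
    have split : Set.EqOn
        (fun b : ℝ => b ^ p * (1 + b ^ 2 / 4) ^ m * Real.exp (-(x * b)) +
          1 / 4 * (b ^ (p + 2) * (1 + b ^ 2 / 4) ^ m * Real.exp (-(x * b))))
        (fun b : ℝ => b ^ p * (1 + b ^ 2 / 4) ^ (m + 1) * Real.exp (-(x * b)))
        (Set.Ioi 0) := by
      intro b hb
      have : b ^ (p + 2) = b ^ p * b ^ 2 := by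
        rw [Real.rpow_add hb]; norm_num
      simp only [this]
      ring
    refine ⟨(i₁.add (i₂.const_mul (1 / 4))).congr_fun split measurableSet_Ioi, ?_⟩
    rw [← MeasureTheory.setIntegral_congr_fun measurableSet_Ioi split,
      MeasureTheory.integral_add i₁ (i₂.const_mul _), MeasureTheory.integral_const_mul]
    have hΓ : Real.Gamma (p + 2 + 1) = (p + 2) * ((p + 1) * Real.Gamma (p + 1)) := by
      rw [Real.Gamma_add_one (by linarith), show p + 2 = p + 1 + 1 by ring,
        Real.Gamma_add_one (s := p + 1) (by linarith)]
    have hxp : x ^ (p + 2 + 1) = x ^ (p + 1) * x ^ 2 := by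
      rw [show p + 2 + 1 = p + 1 + 2 by ring, Real.rpow_add hx]; norm_num
    have hG : 0 ≤ Real.Gamma (p + 1) / x ^ (p + 1) :=
      div_nonneg (Real.Gamma_pos_of_pos (by linarith)).le (Real.rpow_pos_of_pos hx _).le
    have hR : Real.Gamma (p + 2 + 1) / x ^ (p + 2 + 1) ≤
        Real.Gamma (p + 1) / x ^ (p + 1) * (q ^ 2 / x ^ 2) := by
      rw [hΓ, hxp, show (p + 2) * ((p + 1) * Real.Gamma (p + 1)) / (x ^ (p + 1) * x ^ 2) =
        Real.Gamma (p + 1) / x ^ (p + 1) * ((p + 2) * (p + 1) / x ^ 2) by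
          field_simp]
      have hm : (0 : ℝ) ≤ m := m.cast_nonneg
      gcongr
      nlinarith
    have hB : 0 ≤ (1 + q ^ 2 / (4 * x ^ 2)) ^ m := by positivity
    calc _ ≤ Real.Gamma (p + 1) / x ^ (p + 1) * (1 + q ^ 2 / (4 * x ^ 2)) ^ m +
          1 / 4 * (Real.Gamma (p + 1) / x ^ (p + 1) * (q ^ 2 / x ^ 2) *
            (1 + q ^ 2 / (4 * x ^ 2)) ^ m) := by
          have := mul_le_mul_of_nonneg_right hR hB
          linarith
      _ = _ := by
          rw [pow_succ _ m, show q ^ 2 / (4 * x ^ 2) = 1 / 4 * (q ^ 2 / x ^ 2) by field_simp]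
          ring

theorem norm_poissonIntegrand (z : ℂ) (r : ℝ) (t : ℂ) :
    ‖poissonIntegrand z r t‖ =
      Real.exp (-(z.re * t.im + z.im * t.re)) * ‖1 - t ^ 2‖ ^ r := by
  rw [poissonIntegrand, norm_mul, Complex.norm_cpow_real, Complex.norm_exp]
  congr 2
  simp
  ring

theorem continuousOn_poissonIntegrand (z : ℂ) {r : ℝ} (hr : 0 < r) :
    ContinuousOn (poissonIntegrand z r) {t | |t.re| ≤ 1} := by
  intro t ht
  refine ContinuousAt.continuousWithinAt ?_
  unfold poissonIntegrand
  refine ContinuousAt.mul (by fun_prop) ?_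
  refine ContinuousAt.comp (f := fun t : ℂ => 1 - t ^ 2) (g := fun w : ℂ => w ^ (r : ℂ)) ?_
    (by fun_prop : ContinuousAt (fun t : ℂ => 1 - t ^ 2) t)
  refine Complex.continuousAt_cpow_const_of_re_pos (Or.inl ?_) (by simpa using hr)
  have : t.re ^ 2 ≤ 1 := (sq_le_one_iff_abs_le_one _).2 ht
  simp [pow_two]
  nlinarith [sq_nonneg t.im]

theorem differentiableAt_poissonIntegrand (z : ℂ) (r : ℝ) {t : ℂ} (ht : |t.re| < 1) :
    DifferentiableAt ℂ (poissonIntegrand z r) t := by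
  unfold poissonIntegrand
  refine DifferentiableAt.mul (by fun_prop) ?_
  refine DifferentiableAt.cpow_const (by fun_prop) (Or.inl ?_)
  have : t.re ^ 2 < 1 := (sq_lt_one_iff_abs_lt_one _).2 ht
  simp [pow_two]
  nlinarith [sq_nonneg t.im]

theorem norm_poissonIntegrand_vertical_le {z : ℂ} (him : |z.im| ≤ 1) {n : ℕ} {r : ℝ} (hr : 0 ≤ r)
    (hrn : r ≤ n) {ε : ℝ} (hε : ε ^ 2 = 1) {b : ℝ} (hb : 0 ≤ b) :
    ‖poissonIntegrand z r (ε + b * Complex.I)‖ ≤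
      Real.exp 1 * 2 ^ r * (b ^ r * (1 + b ^ 2 / 4) ^ n * Real.exp (-(z.re * b))) := by
  rw [norm_poissonIntegrand]
  have h1 : ‖(1 : ℂ) - (ε + b * Complex.I) ^ 2‖ ≤ 2 * (b * (1 + b ^ 2 / 4)) := by
    refine abs_le_of_sq_le_sq' ?_ (by positivity) |>.2
    rw [Complex.sq_norm, Complex.normSq_apply]
    simp [pow_two]
    have h4 : ε * ε = 1 := by rw [← hε]; ring
    have : (1 - (ε * ε - b * b)) * (1 - (ε * ε - b * b)) +
        (-(b * ε) + -(ε * b)) * (-(b * ε) + -(ε * b)) = b ^ 4 + 4 * b ^ 2 * (ε * ε) := by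
      rw [h4]
      linear_combination 4 * b ^ 2 * h4
    nlinarith [sq_nonneg (b ^ 2), sq_nonneg (b ^ 3)]
  have h2 : ‖(1 : ℂ) - (ε + b * Complex.I) ^ 2‖ ^ r ≤ 2 ^ r * (b ^ r * (1 + b ^ 2 / 4) ^ n) := by
    calc _ ≤ (2 * (b * (1 + b ^ 2 / 4))) ^ r := Real.rpow_le_rpow (norm_nonneg _) h1 hr
      _ = 2 ^ r * (b ^ r * (1 + b ^ 2 / 4) ^ r) := by
        rw [Real.mul_rpow two_pos.le (by positivity), Real.mul_rpow hb (by positivity)]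
      _ ≤ 2 ^ r * (b ^ r * (1 + b ^ 2 / 4) ^ (n : ℝ)) := by
        gcongr
        nlinarith [sq_nonneg b]
      _ = _ := by rw [Real.rpow_natCast]
  have h3 : Real.exp (-(z.re * b + z.im * ε)) ≤ Real.exp 1 * Real.exp (-(z.re * b)) := by
    rw [← Real.exp_add]
    refine Real.exp_le_exp.2 ?_
    have : |z.im * ε| ≤ 1 := by
      rw [abs_mul, (pow_eq_one_iff_of_nonneg (abs_nonneg ε) two_ne_zero).1 (by rwa [sq_abs])]
      simpa using him
    linarith [neg_abs_le (z.im * ε)]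
  calc _ ≤ Real.exp 1 * Real.exp (-(z.re * b)) * (2 ^ r * (b ^ r * (1 + b ^ 2 / 4) ^ n)) := by
        refine mul_le_mul ?_ h2 (by positivity) (by positivity)
        simpa using h3
    _ = _ := by ring

theorem norm_poissonIntegrand_horizontal_le {z : ℂ} (hre : 1 ≤ z.re) (him : |z.im| ≤ 1) {n : ℕ}
    {r : ℝ} (hr : 0 ≤ r) (hrn : r ≤ n) {a T : ℝ} (ha : |a| ≤ 1) (hT : 1 ≤ T) :
    ‖poissonIntegrand z r (a + T * Complex.I)‖ ≤
      Real.exp 1 * 3 ^ n * (T ^ (2 * n) * Real.exp (-T)) := by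
  rw [norm_poissonIntegrand]
  have h1 : ‖(1 : ℂ) - (a + T * Complex.I) ^ 2‖ ≤ 3 * T ^ 2 := by
    have ha2 : a ^ 2 ≤ 1 := (sq_le_one_iff_abs_le_one _).2 ha
    have : ‖(a + T * Complex.I : ℂ)‖ ^ 2 = a ^ 2 + T ^ 2 := by
      rw [Complex.sq_norm, Complex.normSq_add_mul_I]
    calc _ ≤ ‖(1 : ℂ)‖ + ‖(a + T * Complex.I : ℂ) ^ 2‖ := norm_sub_le _ _
      _ ≤ _ := by
        rw [norm_pow, this, norm_one]
        nlinarith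
  have h2 : ‖(1 : ℂ) - (a + T * Complex.I) ^ 2‖ ^ r ≤ 3 ^ n * T ^ (2 * n) := by
    calc _ ≤ (3 * T ^ 2) ^ r := Real.rpow_le_rpow (norm_nonneg _) h1 hr
      _ ≤ (3 * T ^ 2) ^ (n : ℝ) := Real.rpow_le_rpow_of_exponent_le (by nlinarith) hrn
      _ = _ := by rw [Real.rpow_natCast, mul_pow, pow_mul]
  have h3 : Real.exp (-(z.re * T + z.im * a)) ≤ Real.exp 1 * Real.exp (-T) := by
    rw [← Real.exp_add]
    refine Real.exp_le_exp.2 ?_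
    have : |z.im * a| ≤ 1 := by
      rw [abs_mul]
      exact mul_le_one₀ him (abs_nonneg _) ha
    nlinarith [neg_abs_le (z.im * a)]
  calc _ ≤ Real.exp 1 * Real.exp (-T) * (3 ^ n * T ^ (2 * n)) := by
        refine mul_le_mul ?_ h2 (by positivity) (by positivity)
        simpa using h3
    _ = _ := by ring

/-- Contour shift: the Poisson integral is bounded by the two vertical integrals. -/
theorem norm_integral_poissonIntegrand_le {z : ℂ} (hre : 1 ≤ z.re) (him : |z.im| ≤ 1) {n : ℕ}
    {r : ℝ} (hr : 0 < r) (hrn : r ≤ n) :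
    ‖∫ t in (-1 : ℝ)..1, poissonIntegrand z r t‖ ≤ 2 * (Real.exp 1 * 2 ^ r *
      ∫ b in Set.Ioi (0 : ℝ), b ^ r * (1 + b ^ 2 / 4) ^ n * Real.exp (-(z.re * b))) := by
  have hx : 0 < z.re := by linarith
  obtain ⟨hint, -⟩ := integral_rpow_mul_one_add_sq_pow_mul_exp_neg_le hx n r _ hr.le le_rfl
  set g : ℝ → ℝ := fun b => b ^ r * (1 + b ^ 2 / 4) ^ n * Real.exp (-(z.re * b)) with hg
  set C := Real.exp 1 * 2 ^ r * ∫ b in Set.Ioi (0 : ℝ), g b with hC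
  have side : ∀ ε : ℝ, ε ^ 2 = 1 → ∀ T : ℝ, 0 ≤ T →
      ‖∫ b in (0 : ℝ)..T, poissonIntegrand z r (ε + b * Complex.I)‖ ≤ C := by
    intro ε hε T hT
    have hi : IntervalIntegrable g MeasureTheory.volume 0 T :=
      (intervalIntegrable_iff_integrableOn_Ioc_of_le hT).2
        (hint.mono_set Set.Ioc_subset_Ioi_self)
    calc _ ≤ ∫ b in (0 : ℝ)..T, Real.exp 1 * 2 ^ r * g b := by
          refine intervalIntegral.norm_integral_le_of_norm_le hT ?_ (hi.const_mul _)
          exact Filter.Eventually.of_forall fun b hb =>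
            norm_poissonIntegrand_vertical_le him hr.le hrn hε hb.1.le
      _ = Real.exp 1 * 2 ^ r * ∫ b in Set.Ioc 0 T, g b := by
          rw [intervalIntegral.integral_const_mul, intervalIntegral.integral_of_le hT]
      _ ≤ C := by
          rw [hC]
          gcongr
          · refine (MeasureTheory.ae_restrict_iff' measurableSet_Ioi).2 ?_
            refine Filter.Eventually.of_forall fun b hb => ?_
            have : (0 : ℝ) ≤ b := le_of_lt hb
            simp only [hg, Pi.zero_apply]
            positivity
          · exact Set.Ioc_subset_Ioi_self
  have key : ∀ T : ℝ, 1 ≤ T → ‖∫ t in (-1 : ℝ)..1, poissonIntegrand z r t‖ ≤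
      2 * C + Real.exp 1 * 3 ^ n * (T ^ (2 * n) * Real.exp (-T)) * 2 := by
    intro T hT
    have hrect := Complex.integral_boundary_rect_eq_zero_of_continuousOn_of_differentiableOn
      (poissonIntegrand z r) (-1) (1 + T * Complex.I)
      ((continuousOn_poissonIntegrand z hr).mono (by
        intro t ht
        have := ht.1
        simp at this
        exact abs_le.2 this))
      (by
        intro t ht
        refine (differentiableAt_poissonIntegrand z r ?_).differentiableWithinAt
        have := ht.1
        simp at this
        exact abs_lt.2 this)
    simp at hrect
    have top : ‖∫ a in (-1 : ℝ)..1, poissonIntegrand z r (a + T * Complex.I)‖ ≤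
        Real.exp 1 * 3 ^ n * (T ^ (2 * n) * Real.exp (-T)) * 2 := by
      have := intervalIntegral.norm_integral_le_of_norm_le_const (a := -1) (b := 1)
        (f := fun a : ℝ => poissonIntegrand z r (a + T * Complex.I))
        (C := Real.exp 1 * 3 ^ n * (T ^ (2 * n) * Real.exp (-T))) (by
          intro a ha
          rw [Set.uIoc_of_le (by norm_num)] at ha
          exact norm_poissonIntegrand_horizontal_le hre him hr.le hrn
            (abs_le.2 ⟨ha.1.le, ha.2⟩) hT)
      norm_num at this ⊢
      exact this
    have s1 := side 1 (by norm_num) T (by linarith)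
    have s2 := side (-1) (by norm_num) T (by linarith)
    push_cast at s1 s2
    have e : ∫ t in (-1 : ℝ)..1, poissonIntegrand z r t =
        (∫ a in (-1 : ℝ)..1, poissonIntegrand z r (a + T * Complex.I)) -
        Complex.I * (∫ b in (0 : ℝ)..T, poissonIntegrand z r (1 + b * Complex.I)) +
        Complex.I * (∫ b in (0 : ℝ)..T, poissonIntegrand z r (-1 + b * Complex.I)) := by
      linear_combination hrect
    rw [e]
    refine (norm_add_le _ _).trans ?_
    refine (add_le_add_left (norm_sub_le _ _) _).trans ?_
    simp only [norm_mul, Complex.norm_I, one_mul]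
    linarith
  have lim : Filter.Tendsto
      (fun T : ℝ => 2 * C + Real.exp 1 * 3 ^ n * (T ^ (2 * n) * Real.exp (-T)) * 2)
      Filter.atTop (nhds (2 * C)) := by
    simpa using ((Real.tendsto_pow_mul_exp_neg_atTop_nhds_zero (2 * n)).const_mul
      (Real.exp 1 * 3 ^ n)).mul_const 2 |>.const_add (2 * C)
  exact ge_of_tendsto lim ((Filter.eventually_ge_atTop 1).mono key)

theorem hasDerivAt_poissonIntegrand (z : ℂ) (r : ℝ) {t : ℂ} (ht : |t.re| < 1) :
    HasDerivAt (poissonIntegrand z r)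
      (Complex.I * z * poissonIntegrand z r t - 2 * r * t * poissonIntegrand z (r - 1) t) t := by
  have hs : (1 : ℂ) - t ^ 2 ∈ Complex.slitPlane := by
    refine Or.inl ?_
    have : t.re ^ 2 < 1 := (sq_lt_one_iff_abs_lt_one _).2 ht
    simp [pow_two]
    nlinarith [sq_nonneg t.im]
  have h1 : HasDerivAt (fun w : ℂ => 1 - w ^ 2) (-(2 * t)) t := by
    simpa using ((hasDerivAt_id t).pow 2).const_sub 1
  have h2 : HasDerivAt (fun w : ℂ => Complex.exp (Complex.I * z * w))
      (Complex.exp (Complex.I * z * t) * (Complex.I * z)) t := by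
    simpa using ((hasDerivAt_id t).const_mul (Complex.I * z)).cexp
  refine HasDerivAt.congr_deriv (f := poissonIntegrand z r)
    (h2.mul (h1.cpow_const (c := (r : ℂ)) hs)) ?_
  simp only [poissonIntegrand]
  push_cast
  ring

theorem poissonIntegrand_add_one (z : ℂ) (r : ℝ) {t : ℂ} (ht : 1 - t ^ 2 ≠ 0) :
    poissonIntegrand z (r + 1) t = (1 - t ^ 2) * poissonIntegrand z r t := by
  simp only [poissonIntegrand]
  push_cast
  rw [Complex.cpow_add _ _ ht, Complex.cpow_one]
  ring

theorem intervalIntegrable_poissonIntegrand_of_pos (z : ℂ) {r : ℝ} (hr : 0 < r) :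
    IntervalIntegrable (fun t : ℝ => poissonIntegrand z r t) MeasureTheory.volume (-1) 1 := by
  refine ContinuousOn.intervalIntegrable ?_
  refine (continuousOn_poissonIntegrand z hr).comp Complex.continuous_ofReal.continuousOn ?_
  intro t ht
  rw [Set.uIcc_of_le (by norm_num)] at ht
  simpa using abs_le.2 ht

theorem intervalIntegrable_poissonIntegrand_neg_half (z : ℂ) :
    IntervalIntegrable (fun t : ℝ => poissonIntegrand z (-(1 / 2)) t)
      MeasureTheory.volume (-1) 1 := by
  have h : IntervalIntegrable (fun t : ℝ => 1 / √(1 - t ^ 2)) MeasureTheory.volume (-1) 1 := by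
    refine intervalIntegral.intervalIntegrable_deriv_of_nonneg (g := Real.arcsin)
      Real.continuous_arcsin.continuousOn (fun t ht => ?_) (fun t _ => by positivity)
    norm_num at ht
    exact Real.hasDerivAt_arcsin ht.1.ne' ht.2.ne
  have h2 : IntervalIntegrable (fun t : ℝ => ((1 / √(1 - t ^ 2) : ℝ) : ℂ))
      MeasureTheory.volume (-1) 1 := ⟨h.1.ofReal, h.2.ofReal⟩
  refine (h2.continuousOn_mul (g := fun t : ℝ => Complex.exp (Complex.I * z * t))
    (by fun_prop)).congr ?_
  intro t ht
  rw [Set.uIoc_of_le (by norm_num)] at ht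
  have ht2 : 0 ≤ 1 - t ^ 2 := by nlinarith [ht.1, ht.2]
  simp only [poissonIntegrand]
  congr 1
  rw [show (1 : ℂ) - (t : ℂ) ^ 2 = ((1 - t ^ 2 : ℝ) : ℂ) by push_cast; ring,
    ← Complex.ofReal_cpow ht2, Real.rpow_neg ht2, ← Real.sqrt_eq_rpow, one_div]

theorem integral_poissonIntegrand_neg_half (z : ℂ) :
    ∫ t in (-1 : ℝ)..1, poissonIntegrand z (-(1 / 2)) t =
      2 * (∫ t in (-1 : ℝ)..1, poissonIntegrand z (1 / 2) t) -
        z ^ 2 / 3 * ∫ t in (-1 : ℝ)..1, poissonIntegrand z (3 / 2) t := by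
  have i₀ := intervalIntegrable_poissonIntegrand_neg_half z
  have i₁ := intervalIntegrable_poissonIntegrand_of_pos z (r := 1 / 2) (by norm_num)
  have i₂ := intervalIntegrable_poissonIntegrand_of_pos z (r := 3 / 2) (by norm_num)
  have cont : ∀ r : ℝ, 0 < r →
      ContinuousOn (fun t : ℝ => poissonIntegrand z r t) (Set.Icc (-1) 1) := fun r hr =>
    (continuousOn_poissonIntegrand z hr).comp Complex.continuous_ofReal.continuousOn
      fun t ht => by simpa using abs_le.2 ht
  have ftc := intervalIntegral.integral_eq_sub_of_hasDerivAt_of_le (a := -1) (b := 1)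
    (f := fun t : ℝ => Complex.I * z / 3 * poissonIntegrand z (3 / 2) t +
      t * poissonIntegrand z (1 / 2) t)
    (f' := fun t : ℝ => 2 * poissonIntegrand z (1 / 2) t -
      z ^ 2 / 3 * poissonIntegrand z (3 / 2) t - poissonIntegrand z (-(1 / 2)) t)
    (by norm_num)
    ((continuousOn_const.mul (cont _ (by norm_num))).add
      (Complex.continuous_ofReal.continuousOn.mul (cont _ (by norm_num))))
    (by
      intro t ht
      have ht' : |(t : ℂ).re| < 1 := by simpa using abs_lt.2 ht
      have hne : (1 : ℂ) - (t : ℂ) ^ 2 ≠ 0 := by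
        have : (1 : ℝ) - t ^ 2 ≠ 0 := by nlinarith [ht.1, ht.2]
        exact_mod_cast this
      have d := (((hasDerivAt_poissonIntegrand z (3 / 2) ht').const_mul
        (Complex.I * z / 3)).add ((hasDerivAt_id (t : ℂ)).mul
          (hasDerivAt_poissonIntegrand z (1 / 2) ht'))).comp_ofReal
      refine d.congr_deriv ?_
      have e₁ := poissonIntegrand_add_one z (-(1 / 2)) hne
      have e₂ := poissonIntegrand_add_one z (1 / 2) hne
      norm_num at e₁ e₂ ⊢
      rw [e₂, e₁]
      linear_combination (z ^ 2 / 3 * (1 - (t : ℂ) ^ 2) ^ 2 *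
        poissonIntegrand z (-(1 / 2)) t) * Complex.I_sq)
    (((i₁.const_mul 2).sub (i₂.const_mul _)).sub i₀)
  rw [intervalIntegral.integral_sub ((i₁.const_mul 2).sub (i₂.const_mul _)) i₀,
    intervalIntegral.integral_sub (i₁.const_mul 2) (i₂.const_mul _),
    intervalIntegral.integral_const_mul, intervalIntegral.integral_const_mul] at ftc
  have z₁ : ∀ r : ℝ, r ≠ 0 → ∀ t : ℂ, t ^ 2 = 1 → poissonIntegrand z r t = 0 := by
    intro r hr t ht
    simp [poissonIntegrand, ht, hr]
  simp only [z₁ (3 / 2) (by norm_num) ((1 : ℝ) : ℂ) (by norm_num),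
    z₁ (1 / 2) (by norm_num) ((1 : ℝ) : ℂ) (by norm_num),
    z₁ (3 / 2) (by norm_num) ((-1 : ℝ) : ℂ) (by norm_num),
    z₁ (1 / 2) (by norm_num) ((-1 : ℝ) : ℂ) (by norm_num)] at ftc
  linear_combination -ftc

theorem besselJPlus_eq (n : ℕ) (z : ℂ) :
    besselJPlus n z =
      ((z / 2) ^ n / ((Real.Gamma ((n : ℝ) + 1 / 2) : ℂ) * (Real.Gamma (1 / 2) : ℂ))) *
        ∫ t in (-1 : ℝ)..1, poissonIntegrand z ((n : ℝ) - 1 / 2) t := rfl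

theorem besselJPlus_zero_eq {z : ℂ} (hz : z ≠ 0) :
    besselJPlus 0 z = 2 / z * besselJPlus 1 z - besselJPlus 2 z := by
  have g₁ : Real.Gamma (1 + 1 / 2) = 1 / 2 * √π := by
    rw [add_comm, Real.Gamma_add_one (by norm_num), Real.Gamma_one_half_eq]
  have g₂ : Real.Gamma (2 + 1 / 2) = 3 / 4 * √π := by
    rw [show (2 : ℝ) + 1 / 2 = (1 + 1 / 2) + 1 by norm_num, Real.Gamma_add_one (by norm_num), g₁]
    ring
  have hπ : (√π : ℂ) ≠ 0 := by
    exact_mod_cast (Real.sqrt_pos.2 Real.pi_pos).ne'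
  simp only [besselJPlus_eq, Nat.cast_zero, Nat.cast_one, Nat.cast_ofNat, zero_add, g₁, g₂,
    Real.Gamma_one_half_eq]
  rw [show (0 : ℝ) - 1 / 2 = -(1 / 2) by norm_num, show (1 : ℝ) - 1 / 2 = 1 / 2 by norm_num,
    show (2 : ℝ) - 1 / 2 = 3 / 2 by norm_num, integral_poissonIntegrand_neg_half]
  push_cast
  field_simp
  ring

theorem norm_besselJPlus_neg (n : ℕ) (z : ℂ) : ‖besselJPlus n (-z)‖ = ‖besselJPlus n z‖ := by
  have h : ∫ t in (-1 : ℝ)..1, poissonIntegrand (-z) ((n : ℝ) - 1 / 2) t =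
      ∫ t in (-1 : ℝ)..1, poissonIntegrand z ((n : ℝ) - 1 / 2) t := by
    have := intervalIntegral.integral_comp_neg (a := -1) (b := 1)
      (fun t : ℝ => poissonIntegrand z ((n : ℝ) - 1 / 2) t)
    rw [neg_neg] at this
    rw [← this]
    refine intervalIntegral.integral_congr fun t _ => ?_
    simp [poissonIntegrand]
  simp only [besselJPlus_eq, h, norm_mul, norm_div, norm_pow, norm_neg]

theorem norm_besselJPlus_le_of_one_le {n : ℕ} (hn : 1 ≤ n) {z : ℂ} (hre : 234 ≤ z.re)
    (hnz : 6.9 * (n : ℝ) ^ 3 ≤ z.re ^ 2) (him : |z.im| ≤ 1) :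
    ‖besselJPlus n z‖ ≤ 3.1 * ‖z‖ ^ (-1 / 2 : ℝ) := by
  have hn1 : (1 : ℝ) ≤ n := by exact_mod_cast hn
  set x := z.re with hxdef
  have hx : 0 < x := by linarith
  have hzx : x ≤ ‖z‖ := (le_abs_self _).trans (Complex.abs_re_le_norm z)
  have hz : 0 < ‖z‖ := hx.trans_le hzx
  have hI := norm_integral_poissonIntegrand_le (z := z) (n := n) (r := n - 1 / 2)
    (by linarith) him (by linarith) (by linarith)
  have hM := (integral_rpow_mul_one_add_sq_pow_mul_exp_neg_le hx n (n - 1 / 2) (3 * n)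
    (by linarith) (by linarith)).2
  rw [show (n : ℝ) - 1 / 2 + 1 = n + 1 / 2 by ring] at hM
  set G := Real.Gamma ((n : ℝ) + 1 / 2) with hG
  have hGpos : 0 < G := Real.Gamma_pos_of_pos (by linarith)
  set E := (1 + (3 * (n : ℝ)) ^ 2 / (4 * x ^ 2)) ^ n with hE
  have hI' := hI.trans (mul_le_mul_of_nonneg_left
    (mul_le_mul_of_nonneg_left hM (by positivity)) two_pos.le)
  have hratio : (‖z‖ / x) ^ ((n : ℝ) + 1 / 2) ≤ (1 + 1 / x ^ 2) ^ n := by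
    have h1 : (‖z‖ / x) ^ 2 ≤ 1 + 1 / x ^ 2 := by
      rw [div_pow, Complex.sq_norm, Complex.normSq_apply, ← hxdef]
      have : z.im * z.im ≤ 1 := by
        nlinarith [(sq_le_one_iff_abs_le_one _).2 him]
      rw [show 1 + 1 / x ^ 2 = (x * x + 1) / x ^ 2 by field_simp]
      gcongr
    calc _ ≤ (‖z‖ / x) ^ (((2 * n : ℕ) : ℝ)) := by
          refine Real.rpow_le_rpow_of_exponent_le ((one_le_div hx).2 hzx) ?_
          push_cast
          linarith
      _ = ((‖z‖ / x) ^ 2) ^ n := by rw [Real.rpow_natCast, pow_mul]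
      _ ≤ _ := by gcongr
  have hexp : (1 + 1 / x ^ 2) ^ n * E ≤ 1.4 := by
    have e1 : (1 + 1 / x ^ 2) ^ n ≤ Real.exp (n * (1 / x ^ 2)) := by
      rw [Real.exp_nat_mul]
      gcongr
      linarith [Real.add_one_le_exp (1 / x ^ 2)]
    have e2 : E ≤ Real.exp (n * ((3 * (n : ℝ)) ^ 2 / (4 * x ^ 2))) := by
      rw [Real.exp_nat_mul, hE]
      gcongr
      linarith [Real.add_one_le_exp ((3 * (n : ℝ)) ^ 2 / (4 * x ^ 2))]
    have hnx : (n : ℝ) ≤ 0.001 * x ^ 2 := by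
      rcases le_or_gt (n : ℝ) 20 with h | h
      · nlinarith
      · nlinarith [mul_pos (sub_pos.2 h) (sub_pos.2 h), mul_pos (show (0 : ℝ) < n by linarith)
          (show (0 : ℝ) < (n : ℝ) ^ 2 - 400 by nlinarith)]
    have e3 : n * (1 / x ^ 2) + n * ((3 * (n : ℝ)) ^ 2 / (4 * x ^ 2)) ≤ 0.328 := by
      rw [show n * (1 / x ^ 2) + n * ((3 * (n : ℝ)) ^ 2 / (4 * x ^ 2)) =
        (n + 9 / 4 * (n : ℝ) ^ 3) / x ^ 2 by field_simp; ring, div_le_iff₀ (by positivity)]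
      linarith
    have e4 : Real.exp 0.328 ≤ 1.4 := by
      refine le_of_pow_le_pow_left₀ three_ne_zero (by norm_num) ?_
      rw [← Real.exp_nat_mul]
      have : Real.exp (((3 : ℕ) : ℝ) * 0.328) ≤ Real.exp 1 := Real.exp_le_exp.2 (by norm_num)
      linarith [Real.exp_one_lt_d9, show (2.72 : ℝ) ≤ 1.4 ^ 3 by norm_num]
    calc _ ≤ Real.exp (n * (1 / x ^ 2)) *
          Real.exp (n * ((3 * (n : ℝ)) ^ 2 / (4 * x ^ 2))) := by gcongr
      _ ≤ _ := by
          rw [← Real.exp_add]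
          exact (Real.exp_le_exp.2 e3).trans e4
  have hsqrt : 2.505 ≤ √2 * √π := by
    rw [← Real.sqrt_mul two_pos.le]
    exact Real.le_sqrt_of_sq_le (by norm_num; linarith [Real.pi_gt_d2])
  have h2 : (2 : ℝ) ^ ((n : ℝ) - 1 / 2) = 2 ^ n / √2 := by
    rw [Real.rpow_sub two_pos, Real.rpow_natCast, Real.sqrt_eq_rpow]
  have hzn : ‖z‖ ^ n = ‖z‖ ^ ((n : ℝ) + 1 / 2) * ‖z‖ ^ (-1 / 2 : ℝ) := by
    rw [← Real.rpow_add hz, ← Real.rpow_natCast]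
    congr 1
    ring
  have hnorm : ‖besselJPlus n z‖ = (‖z‖ / 2) ^ n / (G * √π) *
      ‖∫ t in (-1 : ℝ)..1, poissonIntegrand z ((n : ℝ) - 1 / 2) t‖ := by
    rw [besselJPlus_eq, Real.Gamma_one_half_eq, norm_mul, norm_div, norm_mul, norm_pow, norm_div,
      Complex.norm_real, Complex.norm_real, Real.norm_of_nonneg hGpos.le,
      Real.norm_of_nonneg (Real.sqrt_nonneg _)]
    simp
  have hs2 : 0 < √2 * √π := by positivity
  rw [hnorm]
  calc _ ≤ (‖z‖ / 2) ^ n / (G * √π) *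
        (2 * (Real.exp 1 * 2 ^ ((n : ℝ) - 1 / 2) * (G / x ^ ((n : ℝ) + 1 / 2) * E))) := by
        gcongr
    _ = 2 * Real.exp 1 / (√2 * √π) * ((‖z‖ / x) ^ ((n : ℝ) + 1 / 2) * E) *
        ‖z‖ ^ (-1 / 2 : ℝ) := by
        rw [h2, div_pow, hzn, Real.div_rpow hz.le hx.le]
        have := (Real.rpow_pos_of_pos hx ((n : ℝ) + 1 / 2)).ne'
        field_simp
    _ ≤ 2 * 2.7183 / 2.505 * 1.4 * ‖z‖ ^ (-1 / 2 : ℝ) := by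
        have : (‖z‖ / x) ^ ((n : ℝ) + 1 / 2) * E ≤ 1.4 :=
          (mul_le_mul_of_nonneg_right hratio (by positivity)).trans hexp
        have he : Real.exp 1 ≤ 2.7183 := by linarith [Real.exp_one_lt_d9]
        gcongr
    _ ≤ _ := by
        gcongr
        norm_num

theorem norm_besselJPlus_zero_le {z : ℂ} (hre : 234 ≤ z.re) (him : |z.im| ≤ 1) :
    ‖besselJPlus 0 z‖ ≤ 3.36 * ‖z‖ ^ (-1 / 2 : ℝ) := by
  have hz : 234 ≤ ‖z‖ := hre.trans ((le_abs_self _).trans (Complex.abs_re_le_norm z))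
  have h₁ := norm_besselJPlus_le_of_one_le (n := 1) le_rfl hre (by norm_num; nlinarith) him
  have h₂ := norm_besselJPlus_le_of_one_le (n := 2) one_le_two hre (by norm_num; nlinarith) him
  rw [besselJPlus_zero_eq (norm_pos_iff.1 (by linarith))]
  have hq : 2 / ‖z‖ ≤ 0.01 := by
    rw [div_le_iff₀ (by linarith)]
    linarith
  have hp : 0 ≤ ‖z‖ ^ (-1 / 2 : ℝ) := by positivity
  calc _ ≤ 2 / ‖z‖ * ‖besselJPlus 1 z‖ + ‖besselJPlus 2 z‖ := by
        refine (norm_sub_le _ _).trans (le_of_eq ?_)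
        simp
    _ ≤ 0.01 * (3.1 * ‖z‖ ^ (-1 / 2 : ℝ)) + 3.1 * ‖z‖ ^ (-1 / 2 : ℝ) := by gcongr
    _ ≤ _ := by linarith

theorem norm_besselJPlus_le {n : ℕ} {z : ℂ} (hre : 234 ≤ z.re)
    (hnz : 6.9 * (n : ℝ) ^ 3 ≤ z.re ^ 2) (him : |z.im| ≤ 1) :
    ‖besselJPlus n z‖ ≤ 3.36 * ‖z‖ ^ (-1 / 2 : ℝ) := by
  rcases Nat.eq_zero_or_pos n with rfl | hn
  · exact norm_besselJPlus_zero_le hre him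
  · refine (norm_besselJPlus_le_of_one_le hn hre hnz him).trans ?_
    gcongr
    norm_num

/-- For `N ≥ 20`, `0 ≤ n ≤ N`, and complex `z` with `|Re z| > 0.95 N^{3/2} ln N` and
`|Im z| ≤ 1`, one has `|J_n^+(z)| ≤ 3.36 |z|^{−1/2}`. -/
theorem besselJPlus_bound (N : ℕ) (hN : 20 ≤ N) (n : ℕ) (hn : n ≤ N) (z : ℂ)
    (hre : 0.95 * (N : ℝ) ^ ((3 : ℝ) / 2) * Real.log N < |z.re|) (him : |z.im| ≤ 1) :
    ‖besselJPlus n z‖ ≤ 3.36 * ‖z‖ ^ ((-1 / 2 : ℝ)) := by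
  have hN' : (20 : ℝ) ≤ N := by exact_mod_cast hN
  have hn' : (n : ℝ) ≤ N := by exact_mod_cast hn
  have hlog : 2.772 ≤ Real.log N := by
    have h16 : Real.log 16 = 4 * Real.log 2 := by
      rw [show (16 : ℝ) = 2 ^ 4 by norm_num, Real.log_pow]
      norm_num
    have := Real.log_le_log (by norm_num : (0 : ℝ) < 16) (by linarith : (16 : ℝ) ≤ N)
    linarith [Real.log_two_gt_d9]
  set P := (N : ℝ) ^ ((3 : ℝ) / 2) with hP
  have hP0 : 0 ≤ P := by positivity
  have hP2 : P ^ 2 = (N : ℝ) ^ 3 := by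
    rw [hP, ← Real.rpow_natCast, ← Real.rpow_mul (by positivity), ← Real.rpow_natCast]
    norm_num
  have hx : 2.63 * P ≤ |z.re| := by nlinarith
  have hcube : (6.9 : ℝ) * N ^ 3 ≤ |z.re| ^ 2 := by nlinarith
  have h234 : 234 ≤ |z.re| := by
    refine abs_le_of_sq_le_sq' ?_ (abs_nonneg _) |>.2
    have : (20 : ℝ) ^ 3 ≤ N ^ 3 := by gcongr
    linarith
  have hnz : (6.9 : ℝ) * n ^ 3 ≤ |z.re| ^ 2 := by
    refine le_trans ?_ hcube
    gcongr
  rcases le_total 0 z.re with h | h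
  · rw [abs_of_nonneg h] at h234 hnz
    exact norm_besselJPlus_le h234 hnz him
  · rw [abs_of_nonpos h] at h234 hnz
    rw [← norm_besselJPlus_neg, ← norm_neg z]
    exact norm_besselJPlus_le (by simpa using h234) (by simpa using hnz) (by simpa using him)
end
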